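/- arXiv:1109.3596 — 2 statements merged into one kernel-verified Lean document; each statement's English description precedes it below -/
import Mathlib

section
/- Let n be an odd composite Carmichael number (so a^(n-1) ≡ 1 (mod n) for all units a of Z/nZ) and suppose there exists a unit b of Z/nZ with b^((n-1)/2) ≡ -1 (mod n). Then the subgroup B' = {a ∈ U(Z/nZ) : a^((n-1)/2) ≡ 1 (mod n)} satisfies |B'| ≤ φ(n)/5. -/
/-- If a unit of `A × B × C` has `k`-th power `-1`, and `-1 ≠ 1` in each factor, then the units
with `k`-th power `1` have index at least `8`. -/
theorem eight_mul_card_pow_eq_one_le {A B C : Type*} [CommRing A] [CommRing B] [CommRing C]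
    [Finite (A × B × C)ˣ] (hA : (-1 : A) ≠ 1) (hB : (-1 : B) ≠ 1) (hC : (-1 : C) ≠ 1) (k : ℕ)
    (b : (A × B × C)ˣ) (hb : (b : A × B × C) ^ k = -1) :
    8 * Nat.card (powMonoidHom k : (A × B × C)ˣ →* (A × B × C)ˣ).ker ≤ Nat.card (A × B × C)ˣ := by
  set f : (A × B × C)ˣ →* (A × B × C)ˣ := powMonoidHom k
  have h1 : (b : A × B × C).1 ^ k = -1 := by simpa using congrArg Prod.fst hb
  have h2 : (b : A × B × C).2.1 ^ k = -1 := by simpa using congrArg (fun x => x.2.1) hb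
  have h3 : (b : A × B × C).2.2 ^ k = -1 := by simpa using congrArg (fun x => x.2.2) hb
  let b₁ : Aˣ := Units.map (RingHom.fst A (B × C)).toMonoidHom b
  let b₂ : Bˣ := Units.map ((RingHom.fst B C).comp (RingHom.snd A (B × C))).toMonoidHom b
  let b₃ : Cˣ := Units.map ((RingHom.snd B C).comp (RingHom.snd A (B × C))).toMonoidHom b
  let w : Bool × Bool × Bool → (A × B × C)ˣ := fun s =>
    MulEquiv.prodUnits.symm (cond s.1 b₁ 1, MulEquiv.prodUnits.symm (cond s.2.1 b₂ 1,
      cond s.2.2 b₃ 1))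
  have hw : ∀ s, ((f (w s) : (A × B × C)ˣ) : A × B × C) =
      (cond s.1 (-1) 1, cond s.2.1 (-1) 1, cond s.2.2 (-1) 1) := by
    rintro ⟨_ | _, _ | _, _ | _⟩ <;>
      simp [f, w, b₁, b₂, b₃, MulEquiv.prodUnits, Prod.ext_iff, h1, h2, h3]
  have hinj : Function.Injective (fun s => (⟨f (w s), w s, rfl⟩ : f.range)) := by
    intro s t hst
    have h : (f (w s) : (A × B × C)ˣ) = f (w t) := congrArg Subtype.val hst
    have h' := congrArg (Units.val) h
    rw [hw, hw] at h'
    obtain ⟨s1, s2, s3⟩ := s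
    obtain ⟨t1, t2, t3⟩ := t
    simp only [Prod.mk.injEq] at h' ⊢
    obtain ⟨e1, e2, e3⟩ := h'
    refine ⟨?_, ?_, ?_⟩
    · cases s1 <;> cases t1 <;> first | rfl | exact absurd e1 hA | exact absurd e1.symm hA
    · cases s2 <;> cases t2 <;> first | rfl | exact absurd e2 hB | exact absurd e2.symm hB
    · cases s3 <;> cases t3 <;> first | rfl | exact absurd e3 hC | exact absurd e3.symm hC
  have hcard := Nat.card_le_card_of_injective _ hinj
  have h8 : Nat.card (Bool × Bool × Bool) = 8 := by simp
  rw [h8, ← Subgroup.index_ker] at hcard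
  rw [← Subgroup.card_mul_index f.ker, mul_comm]
  exact Nat.mul_le_mul_left _ hcard

/-- A modulus `n > 1` all of whose units satisfy `a ^ (n - 1) = 1` is squarefree. -/
theorem squarefree_of_forall_units_pow_eq_one {n : ℕ} (hn : 1 < n)
    (h : ∀ a : (ZMod n)ˣ, (a : ZMod n) ^ (n - 1) = 1) : Squarefree n := by
  rw [Nat.squarefree_iff_prime_squarefree]
  rintro p hp ⟨c, hc⟩
  have hsq : ((p * c : ℕ) : ZMod n) * ((p * c : ℕ) : ZMod n) = 0 := by
    rw [← Nat.cast_mul, ZMod.natCast_eq_zero_iff]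
    exact ⟨c, by rw [hc]; ring⟩
  set x : ZMod n := ((p * c : ℕ) : ZMod n) with hx
  have hpow : ∀ m : ℕ, (1 + x) ^ m = 1 + m * x := by
    intro m
    induction m with
    | zero => simp
    | succ m ih =>
      rw [pow_succ, ih]
      push_cast
      linear_combination (m : ZMod n) * hsq
  have hu := h ⟨1 + x, 1 - x, by linear_combination -hsq, by linear_combination -hsq⟩
  simp only [hpow] at hu
  rw [Nat.cast_sub hn.le, ZMod.natCast_self] at hu
  have hx0 : x = 0 := by
    push_cast at hu
    linear_combination -hu
  rw [hx, ZMod.natCast_eq_zero_iff] at hx0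
  have hpos : 0 < p * c := by
    rcases Nat.eq_zero_or_pos (p * c) with h0 | h0
    · rw [mul_assoc, h0] at hc; omega
    · exact h0
  have hle := Nat.le_of_dvd hpos hx0
  have := hp.two_le
  nlinarith

/-- If all units `a` modulo `n` satisfy `a ^ k = 1`, then `p - 1 ∣ k` for each prime `p ∣ n`. -/
theorem sub_one_dvd_of_forall_units_pow_eq_one {n k p : ℕ} [NeZero n] (hp : p.Prime) (hpn : p ∣ n)
    (h : ∀ a : (ZMod n)ˣ, (a : ZMod n) ^ k = 1) : p - 1 ∣ k := by
  have := Fact.mk hp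
  rw [← ZMod.card_units p, ← Nat.card_eq_fintype_card, ← IsCyclic.exponent_eq_card]
  refine Monoid.exponent_dvd_of_forall_pow_eq_one fun u => ?_
  obtain ⟨a, rfl⟩ := ZMod.unitsMap_surjective hpn u
  have ha : a ^ k = 1 := Units.ext (by simpa using h a)
  rw [← map_pow, ha, map_one]

/-- A composite modulus `n` all of whose units satisfy `a ^ (n - 1) = 1` is a product of three
pairwise coprime factors greater than `1`. -/
theorem exists_three_coprime_factors {n : ℕ} (hn : 1 < n) (hcomp : ¬ n.Prime)
    (h : ∀ a : (ZMod n)ˣ, (a : ZMod n) ^ (n - 1) = 1) :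
    ∃ p q r : ℕ, 1 < p ∧ 1 < q ∧ 1 < r ∧ p.Coprime (q * r) ∧ q.Coprime r ∧ n = p * (q * r) := by
  have : NeZero n := ⟨by omega⟩
  have hsf := squarefree_of_forall_units_pow_eq_one hn h
  have hp := Nat.minFac_prime hn.ne'
  obtain ⟨m, hm⟩ := Nat.minFac_dvd n
  set p := n.minFac
  have hm1 : m ≠ 1 := by
    rintro rfl
    rw [mul_one] at hm
    exact hcomp (hm ▸ hp)
  have hq := Nat.minFac_prime hm1
  obtain ⟨r, hr⟩ := Nat.minFac_dvd m
  set q := m.minFac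
  have hpm : p.Coprime m := Nat.coprime_of_squarefree_mul (hm ▸ hsf)
  have hqr : q.Coprime r :=
    Nat.coprime_of_squarefree_mul (hr ▸ hsf.squarefree_of_dvd ⟨p, by rw [hm, mul_comm]⟩)
  refine ⟨p, q, r, hp.one_lt, hq.one_lt, ?_, hr ▸ hpm, hqr, hr ▸ hm⟩
  have hr0 : r ≠ 0 := by
    rintro rfl
    rw [hr] at hm
    simp at hm
    omega
  by_contra hlt
  have hr1 : r = 1 := by omega
  rw [hr1, mul_one] at hr
  rw [hr] at hm hpm
  have d1 := sub_one_dvd_of_forall_units_pow_eq_one hp ⟨q, hm⟩ h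
  have d2 := sub_one_dvd_of_forall_units_pow_eq_one hq ⟨p, by rw [hm, mul_comm]⟩ h
  obtain ⟨s, hs⟩ : ∃ s, p = s + 1 := ⟨p - 1, by have := hp.one_lt; omega⟩
  obtain ⟨t, ht⟩ : ∃ t, q = t + 1 := ⟨q - 1, by have := hq.one_lt; omega⟩
  rw [hs, ht] at hm
  have e1 : n - 1 = s * (t + 1) + t := by
    rw [hm, add_mul, one_mul, ← add_assoc, Nat.add_sub_cancel]
  have e2 : n - 1 = t * (s + 1) + s := by rw [e1]; ring
  rw [hs, Nat.add_sub_cancel, e1] at d1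
  rw [ht, Nat.add_sub_cancel, e2] at d2
  have hst : s = t := Nat.dvd_antisymm ((Nat.dvd_add_right (Dvd.intro _ rfl)).1 d1)
    ((Nat.dvd_add_right (Dvd.intro _ rfl)).1 d2)
  rw [hs, ht, hst, Nat.coprime_self] at hpm
  have := hq.one_lt
  omega


/-- Let `n` be an odd composite Carmichael number admitting a unit `b` with
`b ^ ((n-1)/2) ≡ -1 (mod n)`. Then the subgroup
`B' = {a ∈ U(ℤ/nℤ) : a ^ ((n-1)/2) ≡ 1 (mod n)}` satisfies `|B'| ≤ φ(n)/5`. -/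
theorem stmt_8 (n : ℕ) (hn : 1 < n) (hodd : Odd n) (hcomp : ¬ n.Prime)
    (hcarmichael : ∀ a : (ZMod n)ˣ, (a : ZMod n) ^ (n - 1) = 1)
    (hb : ∃ b : (ZMod n)ˣ, (b : ZMod n) ^ ((n - 1) / 2) = -1) :
    Nat.card {a : (ZMod n)ˣ // (a : ZMod n) ^ ((n - 1) / 2) = 1} ≤ n.totient / 5 := by
  obtain ⟨p, q, r, hp, hq, hr, hpqr, hqr, rfl⟩ := exists_three_coprime_factors hn hcomp hcarmichael
  obtain ⟨b, hb⟩ := hb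
  have hneg : ∀ m : ℕ, 1 < m → m ∣ p * (q * r) → (-1 : ZMod m) ≠ 1 := by
    intro m hm hdvd
    have hmodd : Odd m := hodd.of_dvd_nat hdvd
    have : Fact (2 < m) := ⟨by obtain ⟨j, hj⟩ := hmodd; omega⟩
    exact ZMod.neg_one_ne_one
  have hA := hneg p hp (Dvd.intro _ rfl)
  have hB := hneg q hq ⟨p * r, by ring⟩
  have hC := hneg r hr ⟨p * q, by ring⟩
  have : NeZero (p * (q * r)) := ⟨by omega⟩
  generalize (p * (q * r) - 1) / 2 = k at hb ⊢
  let e : ZMod (p * (q * r)) ≃+* ZMod p × ZMod q × ZMod r :=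
    (ZMod.chineseRemainder hpqr).trans
      (RingEquiv.prodCongr (RingEquiv.refl _) (ZMod.chineseRemainder hqr))
  let E : (ZMod (p * (q * r)))ˣ ≃* (ZMod p × ZMod q × ZMod r)ˣ := Units.mapEquiv e.toMulEquiv
  have : Finite (ZMod p × ZMod q × ZMod r)ˣ := Finite.of_equiv _ E.toEquiv
  have h8 := eight_mul_card_pow_eq_one_le hA hB hC k (E b)
    (by
      change e (b : ZMod (p * (q * r))) ^ k = -1
      rw [← map_pow, hb, map_neg, map_one])
  have hcard : Nat.card (ZMod p × ZMod q × ZMod r)ˣ = (p * (q * r)).totient := by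
    rw [← Nat.card_congr E.toEquiv, Nat.card_eq_fintype_card, ZMod.card_units_eq_totient]
  have hle : Nat.card {a : (ZMod (p * (q * r)))ˣ // (a : ZMod (p * (q * r))) ^ k = 1} ≤
      Nat.card (powMonoidHom k :
        (ZMod p × ZMod q × ZMod r)ˣ →* (ZMod p × ZMod q × ZMod r)ˣ).ker := by
    refine Nat.card_le_card_of_injective (fun a => ⟨E a.1, ?_⟩) ?_
    · have ha : a.1 ^ k = 1 := Units.ext (by simpa using a.2)
      rw [MonoidHom.mem_ker, powMonoidHom_apply, ← map_pow, ha, map_one]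
    · intro a a' haa
      exact Subtype.ext (E.injective (congrArg Subtype.val haa))
  rw [hcard] at h8
  omega
end

section
/- Let n be an odd composite natural number. Then the number of units a of Z/nZ with a^((n-1)/2) ≡ (a/n) (mod n), where (a/n) is the Jacobi symbol, is at most φ(n)/2. -/
/-- The Jacobi symbol as a multiplicative character of `(ZMod n)ˣ` with values in `ZMod n`. -/
def jacobiUnitsHom (n : ℕ) [NeZero n] : (ZMod n)ˣ →* ZMod n where
  toFun a := ((jacobiSym ((a : ZMod n).val : ℤ) n : ℤ) : ZMod n)
  map_one' := by
    have h : jacobiSym (((1 : ZMod n).val : ℕ) : ℤ) n = jacobiSym 1 n := by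
      apply jacobiSym.mod_left'
      rw [← ZMod.intCast_eq_intCast_iff']
      simp
    rw [Units.val_one, h, jacobiSym.one_left, Int.cast_one]
  map_mul' a b := by
    have h : jacobiSym (((a * b : ZMod n).val : ℕ) : ℤ) n
        = jacobiSym ((a : ZMod n).val * (b : ZMod n).val : ℤ) n := by
      apply jacobiSym.mod_left'
      rw [← ZMod.intCast_eq_intCast_iff']
      simp
    rw [Units.val_mul, h, jacobiSym.mul_left, Int.cast_mul]

/-- The subgroup of bases for which `n` is an Euler pseudoprime. -/
def eulerLiars (n : ℕ) [NeZero n] : Subgroup (ZMod n)ˣ :=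
  ((Units.coeHom (ZMod n)).comp (powMonoidHom ((n - 1) / 2))).eqLocus (jacobiUnitsHom n)

theorem mem_eulerLiars {n : ℕ} [NeZero n] {a : (ZMod n)ˣ} :
    a ∈ eulerLiars n ↔ (a : ZMod n) ^ ((n - 1) / 2)
      = ((jacobiSym ((a : ZMod n).val : ℤ) n : ℤ) : ZMod n) := by
  change ((a ^ ((n - 1) / 2) : (ZMod n)ˣ) : ZMod n) = _ ↔ _
  rw [Units.val_pow_eq_pow_val]
  rfl

theorem pow_pred_eq_one_of_mem_eulerLiars {n : ℕ} [NeZero n] (hodd : Odd n) {a : (ZMod n)ˣ}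
    (ha : a ∈ eulerLiars n) : (a : ZMod n) ^ (n - 1) = 1 := by
  have hk : n - 1 = (n - 1) / 2 * 2 := by
    obtain ⟨k, rfl⟩ := hodd
    omega
  have hcop : ((a : ZMod n).val : ℤ).gcd n = 1 := by
    rw [Int.gcd_natCast_natCast]
    exact ZMod.val_coe_unit_coprime a
  rw [hk, pow_mul, mem_eulerLiars.1 ha, ← Int.cast_pow, jacobiSym.sq_one hcop, Int.cast_one]

theorem one_add_pow_of_mul_self_eq_zero {R : Type*} [CommRing R] {x : R} (hx : x * x = 0)
    (k : ℕ) : (1 + x) ^ k = 1 + k * x := by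
  induction k with
  | zero => simp
  | succ k ih =>
    rw [pow_succ, ih]
    push_cast
    linear_combination (k : R) * hx

theorem eulerLiars_ne_top_of_sq_dvd {n p : ℕ} [NeZero n] (hodd : Odd n) (hp : 1 < p)
    (hpn : p * p ∣ n) : eulerLiars n ≠ ⊤ := by
  obtain ⟨m, hm⟩ := hpn
  have hn : 0 < n := Nat.pos_of_neZero n
  set x : ZMod n := ((p * m : ℕ) : ZMod n) with hx_def
  have hx : x * x = 0 := by
    rw [hx_def, ← Nat.cast_mul, ZMod.natCast_eq_zero_iff]
    exact ⟨m, by rw [hm]; ring⟩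
  have hx0 : x ≠ 0 := by
    rw [hx_def, Ne, ZMod.natCast_eq_zero_iff]
    intro h
    have hm0 : 0 < p * m := by
      rcases Nat.eq_zero_or_pos (p * m) with h0 | h0
      · rw [mul_assoc, h0, mul_zero] at hm
        omega
      · exact h0
    have := Nat.le_of_dvd hm0 h
    nlinarith
  let a : (ZMod n)ˣ := ⟨1 + x, 1 - x, by linear_combination -hx, by linear_combination -hx⟩
  intro htop
  have h1 : (1 + x) ^ (n - 1) = 1 :=
    pow_pred_eq_one_of_mem_eulerLiars hodd (a := a) (htop ▸ Subgroup.mem_top a)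
  have h2 : (1 + x) ^ n = 1 := by simp [one_add_pow_of_mul_self_eq_zero hx]
  rw [← pow_sub_one_mul hn.ne' (1 + x), h1] at h2
  exact hx0 (by linear_combination h2)

theorem exists_jacobiSym_eq_neg_one {p : ℕ} (hp : p.Prime) (hp2 : p ≠ 2) :
    ∃ a : ℕ, jacobiSym a p = -1 := by
  have : Fact p.Prime := ⟨hp⟩
  obtain ⟨b, hb⟩ := FiniteField.exists_nonsquare (F := ZMod p) (by rwa [ZMod.ringChar_zmod_n])
  refine ⟨b.val, ?_⟩
  rw [← jacobiSym.legendreSym.to_jacobiSym, legendreSym.eq_neg_one_iff]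
  simpa using hb

theorem eulerLiars_ne_top_of_coprime {p m : ℕ} [NeZero (p * m)] (hp : p.Prime)
    (hodd : Odd (p * m)) (hm : 1 < m) (hpm : p.Coprime m) : eulerLiars (p * m) ≠ ⊤ := by
  obtain ⟨hpodd, hmodd⟩ := Nat.odd_mul.1 hodd
  have hp0 : NeZero p := ⟨hp.ne_zero⟩
  have hm0 : NeZero m := ⟨by omega⟩
  obtain ⟨b, hb⟩ := exists_jacobiSym_eq_neg_one hp (by rintro rfl; exact absurd hpodd (by decide))
  obtain ⟨c, hcp, hcm⟩ := Nat.chineseRemainder hpm b 1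
  have hJ : jacobiSym c (p * m) = -1 := by
    have h1 : jacobiSym c p = jacobiSym b p :=
      jacobiSym.mod_left' (by exact_mod_cast hcp)
    have h2 : jacobiSym c m = jacobiSym 1 m :=
      jacobiSym.mod_left' (by exact_mod_cast hcm)
    rw [jacobiSym.mul_right, h1, h2, hb, jacobiSym.one_left, mul_one]
  have hcop : c.Coprime (p * m) := by
    by_contra h
    have := (jacobiSym.eq_zero_iff_not_coprime (a := c) (b := p * m)).2
      (by rwa [Int.gcd_natCast_natCast])
    omega
  intro htop
  have hmem : ZMod.unitOfCoprime c hcop ∈ eulerLiars (p * m) := htop ▸ Subgroup.mem_top _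
  have hval : jacobiSym ((c : ZMod (p * m)).val : ℤ) (p * m) = -1 := by
    rw [← hJ]
    apply jacobiSym.mod_left'
    rw [← ZMod.intCast_eq_intCast_iff', Int.cast_natCast, ZMod.natCast_zmod_val, Int.cast_natCast]
  rw [mem_eulerLiars, ZMod.coe_unitOfCoprime, hval] at hmem
  have hcast := congrArg (ZMod.castHom (dvd_mul_left m p) (ZMod m)) hmem
  have hc1 : (c : ZMod m) = 1 := by
    simpa using (ZMod.natCast_eq_natCast_iff c 1 m).2 hcm
  rw [map_pow, map_natCast, map_intCast, hc1, one_pow] at hcast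
  have h2 : ((2 : ℕ) : ZMod m) = 0 := by
    push_cast at hcast ⊢
    linear_combination hcast
  rw [ZMod.natCast_eq_zero_iff] at h2
  have := Nat.le_of_dvd two_pos h2
  obtain ⟨k, rfl⟩ := hmodd
  omega

theorem eulerLiars_ne_top {n : ℕ} [NeZero n] (hodd : Odd n)
    (hcomp : ∃ a b : ℕ, 1 < a ∧ 1 < b ∧ n = a * b) : eulerLiars n ≠ ⊤ := by
  obtain ⟨a, b, ha, hb, rfl⟩ := hcomp
  obtain ⟨p, hp, k, rfl⟩ := Nat.exists_prime_and_dvd ha.ne'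
  by_cases hpm : p ∣ k * b
  · exact eulerLiars_ne_top_of_sq_dvd hodd hp.one_lt
      (by rw [mul_assoc]; exact mul_dvd_mul_left p hpm)
  · have hk : 0 < k := Nat.pos_of_ne_zero (by rintro rfl; omega)
    have h : p * k * b = p * (k * b) := mul_assoc p k b
    revert hodd
    rename_i inst
    revert inst
    rw [h]
    intro inst hodd
    exact eulerLiars_ne_top_of_coprime hp hodd (by nlinarith) ((hp.coprime_iff_not_dvd).2 hpm)

theorem Subgroup.card_le_half_of_ne_top {G : Type*} [Group G] [Finite G] {H : Subgroup G}
    (hH : H ≠ ⊤) : Nat.card H ≤ Nat.card G / 2 := by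
  have h1 : H.index ≠ 1 := mt Subgroup.index_eq_one.1 hH
  have h0 : H.index ≠ 0 := Subgroup.index_ne_zero_of_finite
  rw [Nat.le_div_iff_mul_le two_pos, ← H.card_mul_index]
  exact Nat.mul_le_mul_left _ (by omega)

/-- Solovay–Strassen bound: an odd composite `n` (`n = a·b` with `a, b > 1`)
is an Euler pseudoprime for at most `φ(n)/2` bases, i.e. the number of units
`a` of `ℤ/nℤ` with `a ^ ((n-1)/2) ≡ (a/n) (mod n)` is at most `φ(n)/2`. -/
theorem stmt_11 (n : ℕ) (hodd : Odd n) (hcomp : ∃ a b : ℕ, 1 < a ∧ 1 < b ∧ n = a * b) :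
    Nat.card {a : (ZMod n)ˣ //
        (a : ZMod n) ^ ((n - 1) / 2) = ((jacobiSym ((a : ZMod n).val : ℤ) n : ℤ) : ZMod n)}
      ≤ n.totient / 2 := by
  have : NeZero n := ⟨hodd.pos.ne'⟩
  have h := Subgroup.card_le_half_of_ne_top (eulerLiars_ne_top hodd hcomp)
  rw [Nat.card_eq_fintype_card (α := (ZMod n)ˣ), ZMod.card_units_eq_totient] at h
  simpa only [← mem_eulerLiars] using h
end
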